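/- arXiv:2303.17659 — 3 statements merged into one kernel-verified Lean document; each statement's English description precedes it below -/
import Mathlib

section
/- Let k be a field, V a finite set, S = k[x_v : v ∈ V], and let Δ be a nonempty abstract simplicial complex on V with Stanley–Reisner ideal I_Δ. Then I_Δ = ⋂_F P_F, where F ranges over the facets of Δ and P_F := ( x_v : v ∈ V \ F ); moreover each P_F is a prime ideal of S, and the ideals P_F for F a facet of Δ are precisely the minimal primes of I_Δ. -/
/-- An abstract simplicial complex on a finite vertex set `V`: a family of finite
subsets of `V` that is closed under taking subsets. -/
def IsSimplicialComplex {V : Type*} (Δ : Set (Finset V)) : Prop :=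
  ∀ F ∈ Δ, ∀ G ⊆ F, G ∈ Δ

/-- A facet of `Δ`: a face that is maximal under inclusion. -/
def IsFacet {V : Type*} (Δ : Set (Finset V)) (F : Finset V) : Prop :=
  F ∈ Δ ∧ ∀ G ∈ Δ, F ⊆ G → G = F

/-- The Stanley–Reisner ideal of a family `Δ` of subsets of `V` in the polynomial ring
`k[x_v : v ∈ V]`: the ideal generated by the squarefree monomials `∏_{v ∈ G} x_v`
corresponding to the nonfaces `G ∉ Δ`. -/
noncomputable def stanleyReisnerIdeal {V : Type*} (k : Type*) [Field k]
    (Δ : Set (Finset V)) : Ideal (MvPolynomial V k) :=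
  Ideal.span { p | ∃ G : Finset V, G ∉ Δ ∧ p = ∏ v ∈ G, MvPolynomial.X v }

/-- For a subset `F ⊆ V`, the ideal `P_F = (x_v : v ∈ V \ F)` of `k[x_v : v ∈ V]`
generated by the variables not indexed by `F`. -/
noncomputable def facePrime {V : Type*} (k : Type*) [Field k] (F : Finset V) :
    Ideal (MvPolynomial V k) :=
  Ideal.span { p | ∃ v : V, v ∉ F ∧ p = MvPolynomial.X v }

section FacePrime

variable {V : Type*} {k : Type*} [Field k]

theorem facePrime_eq_span_image (F : Finset V) :
    facePrime k F = Ideal.span (MvPolynomial.X '' {v | v ∉ F}) := by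
  unfold facePrime
  congr 1
  ext p
  simp [eq_comm]

theorem mem_facePrime {F : Finset V} {p : MvPolynomial V k} :
    p ∈ facePrime k F ↔ ∀ m ∈ p.support, ∃ v ∉ F, m v ≠ 0 := by
  rw [facePrime_eq_span_image, MvPolynomial.mem_ideal_span_X_image]
  rfl

theorem X_mem_facePrime {F : Finset V} {v : V} :
    (MvPolynomial.X v : MvPolynomial V k) ∈ facePrime k F ↔ v ∉ F := by
  classical
  simp [mem_facePrime, MvPolynomial.support_X, Finsupp.single_apply]

theorem facePrime_le_iff {F : Finset V} {I : Ideal (MvPolynomial V k)} :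
    facePrime k F ≤ I ↔ ∀ v ∉ F, MvPolynomial.X v ∈ I := by
  rw [facePrime_eq_span_image, Ideal.span_le, Set.image_subset_iff]
  rfl

theorem facePrime_le_facePrime_iff {F G : Finset V} :
    facePrime k F ≤ facePrime k G ↔ G ⊆ F := by
  simp only [facePrime_le_iff, X_mem_facePrime]
  exact ⟨fun h v hv => by_contra fun hF => h v hF hv, fun h v hv hG => hv (h hG)⟩

/-- `P_F` is the kernel of the endomorphism killing the variables outside `F`. -/
theorem isPrime_facePrime (F : Finset V) : (facePrime k F).IsPrime := by
  classical
  let φ : MvPolynomial V k →ₐ[k] MvPolynomial V k :=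
    MvPolynomial.aeval fun v => if v ∈ F then MvPolynomial.X v else 0
  have hφ : (Ideal.Quotient.mkₐ k (facePrime k F)).comp φ =
      Ideal.Quotient.mkₐ k (facePrime k F) := by
    ext v
    by_cases hv : v ∈ F
    · simp [φ, hv]
    · have := Ideal.Quotient.eq_zero_iff_mem.2 (X_mem_facePrime (k := k).2 hv)
      simp [φ, hv, this]
  have hker : facePrime k F = RingHom.ker φ := by
    refine le_antisymm (facePrime_le_iff.2 fun v hv => ?_) fun p hp => ?_
    · simp [RingHom.mem_ker, φ, hv]
    · rw [RingHom.mem_ker] at hp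
      rw [← Ideal.Quotient.eq_zero_iff_mem]
      simpa [hp] using (DFunLike.congr_fun hφ p).symm
  rw [hker]
  exact RingHom.ker_isPrime φ

end FacePrime

section StanleyReisner

variable {V : Type*} {k : Type*} [Field k] {Δ : Set (Finset V)}

theorem IsSimplicialComplex.stanleyReisnerIdeal_le_facePrime (hΔ : IsSimplicialComplex Δ)
    {F : Finset V} (hF : F ∈ Δ) : stanleyReisnerIdeal k Δ ≤ facePrime k F := by
  refine Ideal.span_le.2 ?_
  rintro _ ⟨G, hG, rfl⟩
  obtain ⟨v, hvG, hvF⟩ := Finset.not_subset.1 fun h => hG (hΔ F hF G h)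
  exact Ideal.mem_of_dvd _ (Finset.dvd_prod_of_mem _ hvG) (X_mem_facePrime.2 hvF)

theorem mem_stanleyReisnerIdeal_of_support {p : MvPolynomial V k}
    (hp : ∀ m ∈ p.support, m.support ∉ Δ) : p ∈ stanleyReisnerIdeal k Δ := by
  rw [p.as_sum]
  refine Ideal.sum_mem _ fun m hm => ?_
  rw [MvPolynomial.monomial_eq]
  refine Ideal.mul_mem_left _ _ (Ideal.mem_of_dvd _ ?_ (Ideal.subset_span ⟨_, hp m hm, rfl⟩))
  exact Finset.prod_dvd_prod_of_dvd _ _ fun v hv => dvd_pow_self _ (Finsupp.mem_support_iff.1 hv)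

theorem exists_isFacet_superset [Finite V] {F : Finset V} (hF : F ∈ Δ) :
    ∃ F', IsFacet Δ F' ∧ F ⊆ F' := by
  obtain ⟨F', hle, hmax⟩ := (Set.toFinite Δ).exists_le_maximal hF
  exact ⟨F', ⟨hmax.prop, fun G hG h => (hmax.eq_of_le hG h).symm⟩, hle⟩

theorem exists_isFacet_facePrime_le [Finite V] {Q : Ideal (MvPolynomial V k)} (hQ : Q.IsPrime)
    (hle : stanleyReisnerIdeal k Δ ≤ Q) : ∃ F, IsFacet Δ F ∧ facePrime k F ≤ Q := by
  classical
  have := Fintype.ofFinite V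
  let G : Finset V := {v | MvPolynomial.X v ∉ Q}
  have hG : G ∈ Δ := by
    by_contra hG
    obtain ⟨v, hv, hvQ⟩ := hQ.prod_mem_iff.1 (hle (Ideal.subset_span ⟨G, hG, rfl⟩))
    exact (Finset.mem_filter.1 hv).2 hvQ
  obtain ⟨F, hF, hGF⟩ := exists_isFacet_superset hG
  refine ⟨F, hF, (facePrime_le_facePrime_iff.2 hGF).trans (facePrime_le_iff.2 fun v hv => ?_)⟩
  simpa [G] using hv

end StanleyReisner

/-- For a nonempty abstract simplicial complex `Δ` on a finite set `V`, the Stanley–Reisner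
ideal `I_Δ` is the intersection of the prime ideals `P_F = (x_v : v ∉ F)` as `F` ranges over
the facets of `Δ`; each `P_F` is prime, and these are exactly the minimal primes of `I_Δ`. -/
theorem stanleyReisner_primary_decomposition {V : Type*} [Fintype V] (k : Type*) [Field k]
    (Δ : Set (Finset V)) (hΔ : IsSimplicialComplex Δ) (hne : Δ.Nonempty) :
    stanleyReisnerIdeal k Δ = sInf { I | ∃ F : Finset V, IsFacet Δ F ∧ I = facePrime k F } ∧
    (∀ F : Finset V, IsFacet Δ F → (facePrime k (V := V) F).IsPrime) ∧
    (stanleyReisnerIdeal k Δ).minimalPrimes =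
      { I | ∃ F : Finset V, IsFacet Δ F ∧ I = facePrime k F } := by
  refine ⟨le_antisymm (le_sInf ?_) fun p hp => ?_, fun F _ => isPrime_facePrime F, ?_⟩
  · rintro _ ⟨F, hF, rfl⟩
    exact hΔ.stanleyReisnerIdeal_le_facePrime hF.1
  · refine mem_stanleyReisnerIdeal_of_support fun m hm hmΔ => ?_
    obtain ⟨F, hF, hmF⟩ := exists_isFacet_superset hmΔ
    obtain ⟨v, hvF, hv⟩ := mem_facePrime.1 (Ideal.mem_sInf.1 hp ⟨F, hF, rfl⟩) m hm
    exact hvF (hmF (Finsupp.mem_support_iff.2 hv))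
  · ext Q
    constructor
    · rintro ⟨⟨hQ, hle⟩, hmin⟩
      obtain ⟨F, hF, hFQ⟩ := exists_isFacet_facePrime_le hQ hle
      exact ⟨F, hF, le_antisymm
        (hmin ⟨isPrime_facePrime F, hΔ.stanleyReisnerIdeal_le_facePrime hF.1⟩ hFQ) hFQ⟩
    · rintro ⟨F, hF, rfl⟩
      refine ⟨⟨isPrime_facePrime F, hΔ.stanleyReisnerIdeal_le_facePrime hF.1⟩, ?_⟩
      rintro Q ⟨hQ, hle⟩ hQF
      obtain ⟨G, hG, hGQ⟩ := exists_isFacet_facePrime_le hQ hle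
      rwa [hF.2 G hG.1 (facePrime_le_facePrime_iff.1 (hGQ.trans hQF))] at hGQ
end

section
/- Let k be a field, V a finite set, S = k[x_v : v ∈ V] with the standard grading, and Δ an abstract simplicial complex on V of dimension d with f-vector (f_{−1}, f_0, …, f_d), where f_{i−1} is the number of faces of Δ of cardinality i. Then for every integer m ≥ 1, the k-dimension of the degree-m graded component of S/I_Δ equals Σ_{i=1}^{d+1} f_{i−1} · binom(m−1, i−1). -/
/-- The degree-`m` graded component of the Stanley–Reisner ring `S/I_Δ` with respect to the
standard grading: the image of the space of homogeneous polynomials of degree `m` under the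
quotient map `S → S/I_Δ`. -/
noncomputable def gradedComponent {V : Type*} (k : Type*) [Field k]
    (Δ : Set (Finset V)) (m : ℕ) :
    Submodule k (MvPolynomial V k ⧸ stanleyReisnerIdeal k Δ) :=
  (MvPolynomial.homogeneousSubmodule V k m).map
    (Ideal.Quotient.mkₐ k (stanleyReisnerIdeal k Δ)).toLinearMap

/-- The number of faces of `Δ` having exactly `i` vertices, i.e. the entry `f_{i-1}` of the
`f`-vector of `Δ`. -/
noncomputable def faceCount {V : Type*} (Δ : Set (Finset V)) (i : ℕ) : ℕ :=
  Set.ncard { F | F ∈ Δ ∧ F.card = i }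

open Finset in
/-- The number of exponent vectors of degree `m` with support exactly `F`. -/
lemma card_filter_support_eq {V : Type*} [DecidableEq V] (F : Finset V) (hF : F.Nonempty)
    {m : ℕ} (hm : 1 ≤ m) :
    #{a ∈ F.finsuppAntidiag m | a.support = F} = (m - 1).choose (#F - 1) := by
  have hpos : 0 < #F := hF.card_pos
  have hsum (a : V →₀ ℕ) (ha : a.support = F) : #F ≤ F.sum a := by
    rw [card_eq_sum_ones]
    refine sum_le_sum fun v hv => ?_
    rw [← ha, Finsupp.mem_support_iff] at hv
    lia
  rcases lt_or_ge m #F with hlt | hle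
  · rw [Nat.choose_eq_zero_of_lt (by lia), card_eq_zero, filter_eq_empty_iff]
    intro a ha h
    have := hsum a h
    rw [(mem_finsuppAntidiag.1 ha).1] at this
    lia
  · set e : V →₀ ℕ := Finsupp.indicator F fun _ _ => 1
    have he (v : V) : e v = if v ∈ F then 1 else 0 := by
      simp [e, Finsupp.indicator_apply]
    have hesum : F.sum e = #F := by
      rw [card_eq_sum_ones]
      exact sum_congr rfl fun v hv => by simp [he, hv]
    have hcard : #(F.finsuppAntidiag (m - #F)) = (m - 1).choose (#F - 1) := by
      rw [card_finsuppAntidiag_nat_eq_choose, ← Nat.choose_symm (by lia)]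
      congr 1 <;> lia
    rw [← hcard]
    symm
    refine card_nbij' (· + e) (· - e) ?_ ?_ ?_ ?_
    · intro a ha
      simp only [coe_filter, Set.mem_ofPred_eq, mem_coe, mem_finsuppAntidiag] at ha ⊢
      have hsupp : (a + e).support = F := by
        ext v
        have := @ha.2 v
        simp only [Finsupp.mem_support_iff, Finsupp.add_apply, he] at this ⊢
        grind
      refine ⟨⟨?_, hsupp.subset⟩, hsupp⟩
      simp only [Finsupp.coe_add, Pi.add_apply, sum_add_distrib, hesum, ha.1]
      lia
    · intro a ha
      simp only [coe_filter, Set.mem_ofPred_eq, mem_coe, mem_finsuppAntidiag] at ha ⊢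
      refine ⟨?_, fun v hv => ?_⟩
      · have : F.sum (a - e) + F.sum e = F.sum a := by
          rw [← sum_add_distrib]
          refine sum_congr rfl fun v hv => ?_
          have h1 : a v ≠ 0 := by rwa [← Finsupp.mem_support_iff, ha.2]
          simp only [Finsupp.tsub_apply, he, hv, if_true]
          lia
        lia
      · rw [← ha.2, Finsupp.mem_support_iff]
        rw [Finsupp.mem_support_iff, Finsupp.tsub_apply] at hv
        lia
    · intro a _
      exact add_tsub_cancel_right a e
    · intro a ha
      simp only [coe_filter, Set.mem_ofPred_eq] at ha
      refine tsub_add_cancel_of_le fun v => ?_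
      rw [he]
      split_ifs with hv
      · rw [← ha.2, Finsupp.mem_support_iff] at hv
        lia
      · exact Nat.zero_le _

/-- A polynomial lies in the Stanley–Reisner ideal iff the support of each of its monomials is
a nonface. -/
lemma mem_stanleyReisnerIdeal_iff {V : Type*} (k : Type*) [Field k] {Δ : Set (Finset V)}
    (hΔ : IsSimplicialComplex Δ) (p : MvPolynomial V k) :
    p ∈ stanleyReisnerIdeal k Δ ↔ ∀ a ∈ p.support, a.support ∉ Δ := by
  classical
  let e (G : Finset V) : V →₀ ℕ := ∑ v ∈ G, Finsupp.single v 1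
  have he (G : Finset V) (v : V) : e G v = if v ∈ G then 1 else 0 := by
    simp [e, Finsupp.finsetSum_apply, Finsupp.single_apply]
  have hgen : stanleyReisnerIdeal k Δ =
      Ideal.span ((fun s => MvPolynomial.monomial s (1 : k)) '' (e '' Δᶜ)) := by
    rw [stanleyReisnerIdeal, Set.image_image]
    congr 1
    ext p
    simp [e, MvPolynomial.monomial_sum_one, MvPolynomial.X, eq_comm]
  rw [hgen, MvPolynomial.mem_ideal_span_monomial_image]
  refine forall₂_congr fun a _ => ⟨?_, fun ha => ⟨_, ⟨_, ha, rfl⟩, fun v => ?_⟩⟩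
  · rintro ⟨_, ⟨G, hG, rfl⟩, hle⟩ ha
    refine hG (hΔ _ ha _ fun v hv => ?_)
    have := hle v
    rw [he, if_pos hv] at this
    rw [Finsupp.mem_support_iff]
    lia
  · rw [he]
    split_ifs with hv
    · rw [Finsupp.mem_support_iff] at hv
      lia
    · exact Nat.zero_le _

/-- The monomials of degree `m` supported on faces form a basis of the degree-`m` component of
the Stanley–Reisner ring. -/
lemma finrank_gradedComponent {V : Type*} (k : Type*) [Field k] {Δ : Set (Finset V)}
    (hΔ : IsSimplicialComplex Δ) (m : ℕ) :
    Module.finrank k (gradedComponent k Δ m) =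
      Nat.card {a : V →₀ ℕ | a.degree = m ∧ a.support ∈ Δ} := by
  set T := {a : V →₀ ℕ | a.degree = m ∧ a.support ∈ Δ}
  set f := (Ideal.Quotient.mkₐ k (stanleyReisnerIdeal k Δ)).toLinearMap
  have hf (p : MvPolynomial V k) : f p = 0 ↔ ∀ a ∈ p.support, a.support ∉ Δ := by
    rw [← mem_stanleyReisnerIdeal_iff k hΔ]
    exact Ideal.Quotient.eq_zero_iff_mem
  have hmap : gradedComponent k Δ m = (MvPolynomial.restrictSupport k T).map f := by
    have hhom : MvPolynomial.homogeneousSubmodule V k m =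
        MvPolynomial.restrictSupport k {a | a.degree = m} :=
      MvPolynomial.homogeneousSubmodule_eq_finsupp_supported V k m
    rw [gradedComponent, hhom]
    refine le_antisymm ?_ (Submodule.map_mono (MvPolynomial.restrictSupport_mono _ fun a h => h.1))
    rw [MvPolynomial.restrictSupport_eq_span, Submodule.map_span_le]
    rintro _ ⟨a, ha, rfl⟩
    by_cases haΔ : a.support ∈ Δ
    · exact Submodule.mem_map_of_mem
        ((MvPolynomial.monomial_mem_restrictSupport k).2 (Or.inl ⟨ha, haΔ⟩))
    · have : f (MvPolynomial.monomial a 1) = 0 := by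
        rw [hf]
        intro b hb
        rwa [Finset.mem_singleton.1 (MvPolynomial.support_monomial_subset hb)]
      exact this ▸ Submodule.zero_mem _
  have hinj : Function.Injective (f.domRestrict (MvPolynomial.restrictSupport k T)) := by
    rw [← LinearMap.ker_eq_bot, LinearMap.ker_eq_bot']
    rintro ⟨p, hp⟩ h
    rw [LinearMap.domRestrict_apply, hf] at h
    rw [Subtype.ext_iff]
    refine MvPolynomial.support_eq_empty.1 (Finset.eq_empty_of_forall_notMem fun a ha => ?_)
    exact h a ha (hp ha).2
  rw [hmap, ← LinearMap.range_domRestrict, LinearMap.finrank_range_of_inj hinj,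
    Module.finrank_eq_nat_card_basis (MvPolynomial.basisRestrictSupport k T)]

open Finset in
/-- Counting exponent vectors of degree `m` supported on faces by their support. -/
lemma card_degree_eq_support_mem {V : Type*} [Fintype V] (Δ : Set (Finset V)) (d : ℕ)
    (hdim : ∀ F ∈ Δ, F.card ≤ d + 1) {m : ℕ} (hm : 1 ≤ m) :
    Nat.card {a : V →₀ ℕ | a.degree = m ∧ a.support ∈ Δ} =
      ∑ i ∈ Icc 1 (d + 1), faceCount Δ i * (m - 1).choose (i - 1) := by
  classical
  have hT : {a : V →₀ ℕ | a.degree = m ∧ a.support ∈ Δ} =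
      ({a ∈ (univ : Finset V).finsuppAntidiag m | a.support ∈ Δ} : Finset (V →₀ ℕ)) := by
    ext a
    simp [Finsupp.degree_eq_sum]
  set Φ : Finset (Finset V) := {F | F ∈ Δ ∧ F.Nonempty}
  have hmaps : ∀ F ∈ Φ, #F ∈ Icc 1 (d + 1) := by
    intro F hF
    simp only [Φ, mem_filter, mem_univ, true_and] at hF
    exact mem_Icc.2 ⟨hF.2.card_pos, hdim F hF.1⟩
  rw [hT, Nat.card_coe_set_eq, Set.ncard_coe_finset,
    card_eq_sum_card_fiberwise (f := Finsupp.support) (t := Φ)]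
  · calc _ = ∑ F ∈ Φ, (m - 1).choose (#F - 1) := by
          refine sum_congr rfl fun F hF => ?_
          simp only [Φ, mem_filter, mem_univ, true_and] at hF
          rw [← card_filter_support_eq F hF.2 hm]
          congr 1
          ext a
          simp only [mem_filter, mem_finsuppAntidiag', subset_univ, and_true]
          grind
      _ = ∑ i ∈ Icc 1 (d + 1), ∑ F ∈ Φ with #F = i, (m - 1).choose (#F - 1) :=
          (sum_fiberwise_of_maps_to hmaps _).symm
      _ = _ := by
          refine sum_congr rfl fun i hi => ?_
          have hface : faceCount Δ i = #{F ∈ Φ | #F = i} := by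
            rw [faceCount, ← Set.ncard_coe_finset]
            congr 1
            ext F
            have := (mem_Icc.1 hi).1
            simp only [Φ, coe_filter, mem_filter, mem_univ, true_and, Set.mem_ofPred_eq,
              ← card_pos]
            grind
          rw [hface, ← smul_eq_mul, ← sum_const]
          exact sum_congr rfl fun F hF => by rw [(mem_filter.1 hF).2]
  · intro a ha
    simp only [coe_filter, Set.mem_ofPred_eq, mem_finsuppAntidiag] at ha
    simp only [Φ, coe_filter, mem_univ, true_and, Set.mem_ofPred_eq]
    refine ⟨ha.2, Finsupp.support_nonempty_iff.2 ?_⟩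
    rintro rfl
    simp at ha
    lia

/-- Hilbert function of the Stanley–Reisner ring: if `Δ` is an abstract simplicial complex
of dimension `d` on a finite set `V`, then for every `m ≥ 1` the `k`-dimension of the
degree-`m` component of `S/I_Δ` equals `∑_{i=1}^{d+1} f_{i-1} · binom(m-1, i-1)`. -/
theorem stanleyReisner_hilbert_function {V : Type*} [Fintype V] (k : Type*) [Field k]
    (Δ : Set (Finset V)) (hΔ : IsSimplicialComplex Δ) (d : ℕ)
    (hdim : (∃ F ∈ Δ, F.card = d + 1) ∧ ∀ F ∈ Δ, F.card ≤ d + 1) :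
    ∀ m : ℕ, 1 ≤ m →
      Module.finrank k (gradedComponent k Δ m) =
        ∑ i ∈ Finset.Icc 1 (d + 1), faceCount Δ i * Nat.choose (m - 1) (i - 1) := by
  intro m hm
  rw [finrank_gradedComponent k hΔ, card_degree_eq_support_mem Δ d hdim.2 hm]
end

section
/- Let k be a field, V a finite set, S = k[x_v : v ∈ V], and Δ a nonempty abstract simplicial complex on V of dimension d. Then the Krull dimension of the Stanley–Reisner ring S/I_Δ equals d + 1. -/
/-- A ring has Krull dimension at most `n` if all its quotients by prime ideals do. -/
theorem ringKrullDim_le_of_forall_quotient_isPrime {R : Type*} [CommRing R] (n : WithBot ℕ∞)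
    (h : ∀ p : Ideal R, p.IsPrime → ringKrullDim (R ⧸ p) ≤ n) : ringKrullDim R ≤ n := by
  rw [ringKrullDim, Order.krullDim_eq_iSup_coheight]
  refine iSup_le fun p ↦ ?_
  have hIci : (Set.Ici p : Set (PrimeSpectrum R)) = PrimeSpectrum.zeroLocus p.asIdeal := by
    ext q
    simp [PrimeSpectrum.mem_zeroLocus, ← PrimeSpectrum.asIdeal_le_asIdeal]
  rw [Order.coheight_eq_krullDim_Ici, hIci, ← ringKrullDim_quotient]
  exact h _ p.isPrime

open Classical in
/-- The map `k[x_v : v ∈ V] → k[x_v : v ∈ F]` sending the variables outside `F` to zero. -/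
noncomputable def killOutside {V : Type*} (k : Type*) [Field k] (F : Finset V) :
    MvPolynomial V k →ₐ[k] MvPolynomial F k :=
  MvPolynomial.aeval fun v ↦ if h : v ∈ F then MvPolynomial.X ⟨v, h⟩ else 0

theorem killOutside_X_of_mem {V : Type*} (k : Type*) [Field k] {F : Finset V} {v : V}
    (h : v ∈ F) : killOutside k F (MvPolynomial.X v) = MvPolynomial.X ⟨v, h⟩ := by
  simp [killOutside, h]

theorem killOutside_X_of_notMem {V : Type*} (k : Type*) [Field k] {F : Finset V} {v : V}
    (h : v ∉ F) : killOutside k F (MvPolynomial.X v) = 0 := by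
  simp [killOutside, h]

theorem killOutside_surjective {V : Type*} (k : Type*) [Field k] (F : Finset V) :
    Function.Surjective (killOutside k F) := by
  have h : (killOutside k F).comp (MvPolynomial.rename Subtype.val) = AlgHom.id k _ := by
    ext1 v
    simp [killOutside_X_of_mem k v.2]
  exact fun p ↦ ⟨_, DFunLike.congr_fun h p⟩

theorem stanleyReisnerIdeal_le_ker_killOutside {V : Type*} (k : Type*) [Field k]
    {Δ : Set (Finset V)} (hΔ : IsSimplicialComplex Δ) {F : Finset V} (hF : F ∈ Δ) :
    stanleyReisnerIdeal k Δ ≤ RingHom.ker (killOutside k F) := by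
  refine Ideal.span_le.2 ?_
  rintro _ ⟨G, hG, rfl⟩
  obtain ⟨v, hvG, hvF⟩ := Finset.not_subset.1 fun h ↦ hG (hΔ F hF G h)
  rw [SetLike.mem_coe, RingHom.mem_ker, map_prod]
  exact Finset.prod_eq_zero hvG (killOutside_X_of_notMem k hvF)

theorem ringKrullDim_mvPolynomial_finset {V : Type*} (k : Type*) [Field k] (F : Finset V) :
    ringKrullDim (MvPolynomial F k) = F.card := by
  simp [MvPolynomial.ringKrullDim_of_isNoetherianRing]

/-- A surjection from `k[x_v : v ∈ V]` that vanishes on the variables outside `F` bounds the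
dimension of its target by the size of `F`. -/
theorem ringKrullDim_le_card_of_surjective {V k A : Type*} [Field k] [CommRing A] [Algebra k A]
    (f : MvPolynomial V k →ₐ[k] A) (hf : Function.Surjective f) (F : Finset V)
    (hF : ∀ v ∉ F, f (MvPolynomial.X v) = 0) : ringKrullDim A ≤ F.card := by
  let g : MvPolynomial F k →ₐ[k] A := MvPolynomial.aeval fun v ↦ f (MvPolynomial.X v)
  have hg : g.comp (killOutside k F) = f := by
    ext v
    by_cases hv : v ∈ F
    · simp [killOutside_X_of_mem k hv, g]
    · simp [killOutside_X_of_notMem k hv, hF v hv]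
  have hsurj : Function.Surjective g := by
    refine Function.Surjective.of_comp (g := killOutside k F) ?_
    rwa [← AlgHom.coe_comp, hg]
  exact (ringKrullDim_le_of_surjective g.toRingHom hsurj).trans
    (ringKrullDim_mvPolynomial_finset k F).le

/-- The vertices whose variables avoid a prime of the Stanley–Reisner ring form a face. -/
theorem mem_of_forall_mk_X_notMem {V : Type*} (k : Type*) [Field k] {Δ : Set (Finset V)}
    {p : Ideal (MvPolynomial V k ⧸ stanleyReisnerIdeal k Δ)} [p.IsPrime] {F : Finset V}
    (hF : ∀ v ∈ F, Ideal.Quotient.mk (stanleyReisnerIdeal k Δ) (MvPolynomial.X v) ∉ p) :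
    F ∈ Δ := by
  by_contra hFΔ
  have h0 : Ideal.Quotient.mk (stanleyReisnerIdeal k Δ) (∏ v ∈ F, MvPolynomial.X v) = 0 :=
    Ideal.Quotient.eq_zero_iff_mem.2 (Ideal.subset_span ⟨F, hFΔ, rfl⟩)
  rw [map_prod] at h0
  obtain ⟨v, hv, hvp⟩ := (Ideal.IsPrime.prod_mem_iff (p := p)).1 (h0 ▸ p.zero_mem)
  exact hF v hv hvp

/-- If `Δ` is a nonempty abstract simplicial complex of dimension `d` on a finite set `V`,
then the Krull dimension of its Stanley–Reisner ring `S/I_Δ` equals `d + 1`. -/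
theorem stanleyReisner_krullDim {V : Type*} [Fintype V] (k : Type*) [Field k]
    (Δ : Set (Finset V)) (hΔ : IsSimplicialComplex Δ) (hne : Δ.Nonempty) (d : ℕ)
    (hdim : (∃ F ∈ Δ, F.card = d + 1) ∧ ∀ F ∈ Δ, F.card ≤ d + 1) :
    ringKrullDim (MvPolynomial V k ⧸ stanleyReisnerIdeal k Δ) = d + 1 := by
  classical
  obtain ⟨⟨F, hF, hFcard⟩, hcard⟩ := hdim
  apply le_antisymm
  · refine ringKrullDim_le_of_forall_quotient_isPrime _ fun p hp ↦ ?_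
    let F : Finset V := Finset.univ.filter fun v ↦
      Ideal.Quotient.mk (stanleyReisnerIdeal k Δ) (MvPolynomial.X v) ∉ p
    have hFΔ : F ∈ Δ := mem_of_forall_mk_X_notMem k (p := p) fun v hv ↦ (Finset.mem_filter.1 hv).2
    have hle := ringKrullDim_le_card_of_surjective
      ((Ideal.Quotient.mkₐ k p).comp (Ideal.Quotient.mkₐ k (stanleyReisnerIdeal k Δ)))
      ((Ideal.Quotient.mkₐ_surjective k p).comp (Ideal.Quotient.mkₐ_surjective k _)) F
      fun v hv ↦ Ideal.Quotient.eq_zero_iff_mem.2 (by simpa [F] using hv)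
    exact hle.trans (mod_cast hcard F hFΔ)
  · have hsurj := Ideal.Quotient.lift_surjective_of_surjective (stanleyReisnerIdeal k Δ)
      (f := (killOutside k F).toRingHom)
      (fun _ ha ↦ stanleyReisnerIdeal_le_ker_killOutside k hΔ hF ha) (killOutside_surjective k F)
    have hle := ringKrullDim_le_of_surjective _ hsurj
    rw [ringKrullDim_mvPolynomial_finset, hFcard] at hle
    exact_mod_cast hle
end
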